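/- Let f : [0,∞) → ℝ be càdlàg, define γ₀ := 0 and γ_{k+1} := inf{ t > γ_k : |f(t) − f(γ_k)| ≥ 1 } (with inf ∅ := +∞), and let r > 0 and ε ∈ (0, r/2). Assume: (i) γ_k − γ_{k−1} ≥ 2ε for every k ≥ 1 with γ_{k−1} ≤ r; (ii) |f(x) − f(r)| < 1 for every x ∈ [r − 2ε, r]. Then there exist points x₋ and x₊ with 0 ≤ x₋ ≤ x₊ ≤ r − 2ε such that |f(a) − f(x₋)| ≤ 2 for all a ∈ [x₋, x₋ + ε], |f(b) − f(x₊)| ≤ 2 for all b ∈ [x₊, x₊ + ε], and f(x₊) − f(x₋) ≥ sup{ f(y) − f(x) : 0 ≤ x ≤ y ≤ r } − 4. -/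

import Mathlib

open Set Filter Topology
open scoped ENNReal

/-- Given `f : [0,∞) → ℝ`, the sequence of crossing times `γ₀ := 0`,
`γ_{k+1} := inf{ t > γ_k : |f(t) − f(γ_k)| ≥ 1 }`, with the convention `inf ∅ := +∞`
(values are taken in `ℝ≥0∞`; `sInf ∅ = ⊤` there). -/
noncomputable def gammaSeq (f : ℝ → ℝ) : ℕ → ℝ≥0∞
  | 0 => 0
  | k + 1 => sInf (ENNReal.ofReal ''
      {t : ℝ | gammaSeq f k < ENNReal.ofReal t ∧ 1 ≤ |f t - f (gammaSeq f k).toReal|})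

theorem gammaSeq_le_succ (f : ℝ → ℝ) (k : ℕ) : gammaSeq f k ≤ gammaSeq f (k + 1) := by
  rw [gammaSeq]
  refine le_sInf ?_
  rintro _ ⟨t, ht, rfl⟩
  exact ht.1.le

theorem gammaSeq_monotone (f : ℝ → ℝ) : Monotone (gammaSeq f) :=
  monotone_nat_of_le_succ (gammaSeq_le_succ f)

theorem abs_sub_gammaSeq_lt_one {f : ℝ → ℝ} {k : ℕ} {t : ℝ} (ht : 0 ≤ t)
    (h₁ : gammaSeq f k ≤ ENNReal.ofReal t) (h₂ : ENNReal.ofReal t < gammaSeq f (k + 1)) :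
    |f t - f (gammaSeq f k).toReal| < 1 := by
  rcases h₁.eq_or_lt with h | h
  · simp [h, ENNReal.toReal_ofReal ht]
  · by_contra! hc
    rw [gammaSeq] at h₂
    exact h₂.not_ge (sInf_le ⟨t, ⟨h, hc⟩, rfl⟩)

section Gap

variable {f : ℝ → ℝ} {r δ : ℝ}

theorem add_le_gammaSeq_succ {k : ℕ}
    (hgap : ENNReal.ofReal δ ≤ gammaSeq f (k + 1) - gammaSeq f k) :
    gammaSeq f k + ENNReal.ofReal δ ≤ gammaSeq f (k + 1) :=
  (add_le_add_right hgap _).trans_eq (add_tsub_cancel_of_le (gammaSeq_le_succ f k))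

theorem ofReal_mul_le_gammaSeq (hδ : 0 ≤ δ)
    (hgap : ∀ k : ℕ, gammaSeq f k ≤ ENNReal.ofReal r →
      ENNReal.ofReal δ ≤ gammaSeq f (k + 1) - gammaSeq f k) (k : ℕ)
    (hk : gammaSeq f k ≤ ENNReal.ofReal r) : ENNReal.ofReal (k * δ) ≤ gammaSeq f k := by
  induction k with
  | zero => simp
  | succ k ih =>
    have hk' := (gammaSeq_le_succ f k).trans hk
    refine le_trans ?_ (add_le_gammaSeq_succ (hgap k hk'))
    rw [show ((k + 1 : ℕ) : ℝ) * δ = k * δ + δ by push_cast; ring,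
      ENNReal.ofReal_add (by positivity) hδ]
    gcongr
    exact ih hk'

theorem exists_forall_gammaSeq_le_imp_lt (hr : 0 ≤ r) (hδ : 0 < δ)
    (hgap : ∀ k : ℕ, gammaSeq f k ≤ ENNReal.ofReal r →
      ENNReal.ofReal δ ≤ gammaSeq f (k + 1) - gammaSeq f k) :
    ∃ N : ℕ, ∀ k : ℕ, gammaSeq f k ≤ ENNReal.ofReal r → k < N := by
  obtain ⟨N, hN⟩ := exists_nat_gt (r / δ)
  refine ⟨N, fun k hk => ?_⟩
  have h := (ENNReal.ofReal_le_ofReal_iff hr).1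
    ((ofReal_mul_le_gammaSeq hδ.le hgap k hk).trans hk)
  rw [div_lt_iff₀ hδ] at hN
  exact_mod_cast lt_of_mul_lt_mul_right (h.trans_lt hN) hδ.le

theorem exists_gammaSeq_le_lt_succ (hr : 0 ≤ r) (hδ : 0 < δ)
    (hgap : ∀ k : ℕ, gammaSeq f k ≤ ENNReal.ofReal r →
      ENNReal.ofReal δ ≤ gammaSeq f (k + 1) - gammaSeq f k) {z : ℝ} (hz : z ≤ r) :
    ∃ k : ℕ, gammaSeq f k ≤ ENNReal.ofReal z ∧ ENNReal.ofReal z < gammaSeq f (k + 1) := by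
  obtain ⟨N, hN⟩ := exists_forall_gammaSeq_le_imp_lt hr hδ hgap
  by_contra! h
  have hle : ∀ k, gammaSeq f k ≤ ENNReal.ofReal z := by
    intro k
    induction k with
    | zero => simp [gammaSeq]
    | succ k ih => exact h k ih
  exact lt_irrefl N (hN N ((hle N).trans (ENNReal.ofReal_le_ofReal hz)))

end Gap

/-- The left end of the `k`-th block between crossing times, moved back to `s` if it exceeds `s`. -/
noncomputable def cappedGamma (f : ℝ → ℝ) (s : ℝ) (k : ℕ) : ℝ :=
  min (gammaSeq f k).toReal s

theorem abs_sub_cappedGamma_le_two {f : ℝ → ℝ} {r s : ℝ} (hsr : s ≤ r)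
    (hflat : ∀ x ∈ Icc s r, |f x - f r| < 1) {k : ℕ} {z : ℝ} (hz : 0 ≤ z) (hzr : z ≤ r)
    (h₁ : gammaSeq f k ≤ ENNReal.ofReal z) (h₂ : ENNReal.ofReal z < gammaSeq f (k + 1)) :
    |f z - f (cappedGamma f s k)| ≤ 2 := by
  rcases le_total (gammaSeq f k).toReal s with h | h
  · rw [cappedGamma, min_eq_left h]
    linarith [abs_sub_gammaSeq_lt_one hz h₁ h₂]
  · rw [cappedGamma, min_eq_right h]
    have hsz : s ≤ z := h.trans (ENNReal.toReal_le_of_le_ofReal hz h₁)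
    have hz' := abs_lt.1 (hflat z ⟨hsz, hzr⟩)
    have hs' := abs_lt.1 (hflat s ⟨le_rfl, hsr⟩)
    rw [abs_le]
    constructor <;> linarith

theorem abs_sub_cappedGamma_le_two_of_mem_Icc {f : ℝ → ℝ} {r ε : ℝ} (hε : 0 < ε)
    (hflat : ∀ x ∈ Icc (r - 2 * ε) r, |f x - f r| < 1) {k : ℕ}
    (hk : gammaSeq f k ≠ ⊤)
    (hgap : ENNReal.ofReal (2 * ε) ≤ gammaSeq f (k + 1) - gammaSeq f k) :
    ∀ a ∈ Icc (cappedGamma f (r - 2 * ε) k) (cappedGamma f (r - 2 * ε) k + ε),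
      |f a - f (cappedGamma f (r - 2 * ε) k)| ≤ 2 := by
  rintro a ⟨ha₁, ha₂⟩
  rcases le_total (gammaSeq f k).toReal (r - 2 * ε) with h | h
  · rw [cappedGamma, min_eq_left h] at ha₁ ha₂ ⊢
    have hγ : (0 : ℝ) ≤ (gammaSeq f k).toReal := ENNReal.toReal_nonneg
    have h₂ : ENNReal.ofReal a < gammaSeq f (k + 1) := by
      refine lt_of_lt_of_le ?_ (add_le_gammaSeq_succ hgap)
      rw [← ENNReal.ofReal_toReal hk, ← ENNReal.ofReal_add hγ (by positivity)]
      exact (ENNReal.ofReal_lt_ofReal_iff (by positivity)).2 (by linarith)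
    linarith [abs_sub_gammaSeq_lt_one (hγ.trans ha₁) (ENNReal.le_ofReal_iff_toReal_le hk
      (hγ.trans ha₁) |>.2 ha₁) h₂]
  · rw [cappedGamma, min_eq_right h] at ha₁ ha₂ ⊢
    have ha' := abs_lt.1 (hflat a ⟨ha₁, by linarith⟩)
    have hs' := abs_lt.1 (hflat (r - 2 * ε) ⟨le_rfl, by linarith⟩)
    rw [abs_le]
    constructor <;> linarith

/-- Let `f : [0,∞) → ℝ` be càdlàg, `r > 0`, `ε ∈ (0, r/2)`.  Assume
(i) `γ_k − γ_{k−1} ≥ 2ε` for every `k ≥ 1` with `γ_{k−1} ≤ r`, and (ii)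
`|f(x) − f(r)| < 1` for all `x ∈ [r − 2ε, r]`.  Then there exist `0 ≤ x₋ ≤ x₊ ≤ r − 2ε`
with `|f(a) − f(x₋)| ≤ 2` on `[x₋, x₋+ε]`, `|f(b) − f(x₊)| ≤ 2` on `[x₊, x₊+ε]`, and
`f(x₊) − f(x₋) ≥ sup{ f(y) − f(x) : 0 ≤ x ≤ y ≤ r } − 4`. -/
theorem exists_flat_points_near_barrier
    (f : ℝ → ℝ)
    (hrc : ∀ x : ℝ, 0 ≤ x → Tendsto f (𝓝[≥] x) (𝓝 (f x)))
    (hll : ∀ s : ℝ, 0 < s → ∃ L : ℝ, Tendsto f (𝓝[Ico 0 s] s) (𝓝 L))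
    (r ε : ℝ) (hr : 0 < r) (hε : 0 < ε) (hεr : ε < r / 2)
    (hgap : ∀ k : ℕ, gammaSeq f k ≤ ENNReal.ofReal r →
      ENNReal.ofReal (2 * ε) ≤ gammaSeq f (k + 1) - gammaSeq f k)
    (hflat : ∀ x ∈ Icc (r - 2 * ε) r, |f x - f r| < 1) :
    ∃ xm xp : ℝ, 0 ≤ xm ∧ xm ≤ xp ∧ xp ≤ r - 2 * ε ∧
      (∀ a ∈ Icc xm (xm + ε), |f a - f xm| ≤ 2) ∧
      (∀ b ∈ Icc xp (xp + ε), |f b - f xp| ≤ 2) ∧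
      sSup {d : ℝ | ∃ x y : ℝ, 0 ≤ x ∧ x ≤ y ∧ y ≤ r ∧ d = f y - f x} - 4
        ≤ f xp - f xm := by
  have hs : 0 ≤ r - 2 * ε := by linarith
  have hδ : 0 < 2 * ε := by positivity
  set p := cappedGamma f (r - 2 * ε) with hp
  obtain ⟨N, hN⟩ := exists_forall_gammaSeq_le_imp_lt hr.le hδ hgap
  let S : Set (ℕ × ℕ) := {q | q.1 ≤ q.2 ∧ gammaSeq f q.2 ≤ ENNReal.ofReal r}
  have hSfin : S.Finite := ((finite_Iio N).prod (finite_Iio N)).subset fun q hq =>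
    ⟨hq.1.trans_lt (hN _ hq.2), hN _ hq.2⟩
  have hSne : S.Nonempty := ⟨(0, 0), le_rfl, by simp [gammaSeq]⟩
  obtain ⟨⟨i, j⟩, ⟨hij, hj⟩, hmax⟩ := exists_max_image S (fun q => f (p q.2) - f (p q.1)) hSfin hSne
  have hi : gammaSeq f i ≤ ENNReal.ofReal r := (gammaSeq_monotone f hij).trans hj
  have hj_top : gammaSeq f j ≠ ⊤ := ne_top_of_le_ne_top ENNReal.ofReal_ne_top hj
  have hi_top : gammaSeq f i ≠ ⊤ := ne_top_of_le_ne_top ENNReal.ofReal_ne_top hi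
  refine ⟨p i, p j, le_min ENNReal.toReal_nonneg hs,
    min_le_min_right _ (ENNReal.toReal_mono hj_top (gammaSeq_monotone f hij)), min_le_right _ _,
    abs_sub_cappedGamma_le_two_of_mem_Icc hε hflat hi_top (hgap i hi),
    abs_sub_cappedGamma_le_two_of_mem_Icc hε hflat hj_top (hgap j hj), ?_⟩
  rw [sub_le_iff_le_add]
  refine csSup_le ⟨_, 0, 0, le_rfl, le_rfl, hr.le, rfl⟩ ?_
  rintro _ ⟨x, y, hx, hxy, hy, rfl⟩
  obtain ⟨k, hk₁, hk₂⟩ := exists_gammaSeq_le_lt_succ hr.le hδ hgap (hxy.trans hy)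
  obtain ⟨l, hl₁, hl₂⟩ := exists_gammaSeq_le_lt_succ hr.le hδ hgap hy
  have hkl : k ≤ l := Nat.lt_succ_iff.1 <| (gammaSeq_monotone f).reflect_lt <|
    (hk₁.trans (ENNReal.ofReal_le_ofReal hxy)).trans_lt hl₂
  have hmax' := hmax (k, l) ⟨hkl, hl₁.trans (ENNReal.ofReal_le_ofReal hy)⟩
  have hxk := abs_le.1 <| abs_sub_cappedGamma_le_two (by linarith) hflat hx (hxy.trans hy) hk₁ hk₂
  have hyl := abs_le.1 <|
    abs_sub_cappedGamma_le_two (by linarith) hflat (hx.trans hxy) hy hl₁ hl₂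
  simp only [hp] at hmax' ⊢
  linarith
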